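/- Let Ω ⊂ ℝ^d be a bounded domain, r ∈ (1,∞), and let {v^ε}_{ε∈(0,1)} be a family of functions bounded in L^r(Ω). Then there exist v⁰ ∈ L^r(Ω × Y) and a sequence ε_k → 0 such that v^{ε_k} ⇀ v⁰ weakly two-scale in L^r(Ω × Y) as k → ∞, i.e. ∫_{ℝ^d} ∫_Y v^{ε_k}(T_{ε_k}(x,y)) ψ(x,y) dy dx → ∫_Ω ∫_Y v⁰ ψ for every ψ ∈ L^{r'}(ℝ^d × Y), where the v^{ε_k} are extended by zero outside Ω. -/

import Mathlib

open MeasureTheory Filter Set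

noncomputable section

/-- The unit cell `Y = (0,1]^d`. -/
def Ycell (d : ℕ) : Set (EuclideanSpace ℝ (Fin d)) :=
  {y | ∀ i, y i ∈ Set.Ioc (0 : ℝ) 1}

/-- The componentwise floor map `N(x) = (⌊x₁⌋, …, ⌊x_d⌋)` (viewed in `ℝ^d`). -/
def Ncell {d : ℕ} (x : EuclideanSpace ℝ (Fin d)) : EuclideanSpace ℝ (Fin d) :=
  WithLp.toLp 2 fun i => (⌊x i⌋ : ℝ)

/-- The two-scale composition function `T_ε(x,y) = ε (N(x/ε) + y)`. -/
def Tcell {d : ℕ} (ε : ℝ) (x y : EuclideanSpace ℝ (Fin d)) :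
    EuclideanSpace ℝ (Fin d) :=
  ε • (Ncell (ε⁻¹ • x) + y)

section Riesz
open scoped ENNReal symmDiff
variable {X : Type*} [MeasurableSpace X] {μ : Measure X} [IsFiniteMeasure μ]

/-- Indicators of pairwise disjoint measurable sets sum up in `L^p` to the indicator of the union. -/
theorem hasSum_indicatorConstLp {p : ℝ≥0∞} [Fact (1 ≤ p)] (hp : p ≠ ∞) {f : ℕ → Set X}
    (hf : ∀ i, MeasurableSet (f i)) (hd : Pairwise (Function.onFun Disjoint f)) (c : ℝ) :
    HasSum (fun i => indicatorConstLp p (hf i) (measure_ne_top μ _) c)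
      (indicatorConstLp p (MeasurableSet.iUnion hf) (measure_ne_top μ _) c) := by
  have hF : ∀ F : Finset ℕ, MeasurableSet (⋃ i ∈ F, f i) := fun F =>
    F.measurableSet_biUnion fun i _ => hf i
  have hsum : ∀ F : Finset ℕ, ∑ i ∈ F, indicatorConstLp p (hf i) (measure_ne_top μ _) c
      = indicatorConstLp p (hF F) (measure_ne_top μ _) c := by
    intro F
    induction F using Finset.induction_on with
    | empty => simp
    | insert a F ha ih =>
      rw [Finset.sum_insert ha, ih, ← indicatorConstLp_disjoint_union]
      · simp
      · simp only [disjoint_iUnion_right]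
        intro i hi
        exact hd (by rintro rfl; exact ha hi)
  unfold HasSum
  simp_rw [hsum]
  refine tendsto_indicatorConstLp_set hp ?_
  have hmono : Monotone fun F : Finset ℕ => ⋃ i ∈ F, f i := fun F G h =>
    biUnion_subset_biUnion_left h
  have hU : (⋃ F : Finset ℕ, ⋃ i ∈ F, f i) = ⋃ i, f i :=
    (iUnion_eq_iUnion_finset f).symm
  have h1 := tendsto_measure_iUnion_atTop (μ := μ) hmono
  rw [hU] at h1
  have h2 := ENNReal.Tendsto.sub (tendsto_const_nhds (x := μ (⋃ i, f i)) (f := atTop)) h1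
    (Or.inl (measure_ne_top _ _))
  rw [tsub_self] at h2
  refine h2.congr fun F => ?_
  have hsub : (⋃ i ∈ F, f i) ⊆ ⋃ i, f i := iUnion₂_subset fun i _ => subset_iUnion f i
  rw [symmDiff_of_le hsub, measure_sdiff hsub (hF F).nullMeasurableSet (measure_ne_top _ _)]
  rfl

/-- The signed measure `s ↦ Φ 1_s` induced by a continuous functional on `L^p`. -/
def signedMeasureOfDual {p : ℝ≥0∞} [Fact (1 ≤ p)] (hp : p ≠ ∞) (Φ : StrongDual ℝ (Lp ℝ p μ)) :
    SignedMeasure X := by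
  classical
  exact
  { measureOf' := fun s => if hs : MeasurableSet s then
      Φ (indicatorConstLp p hs (measure_ne_top μ _) 1) else 0
    empty' := by simp
    not_measurable' := fun s hs => by simp [hs]
    m_iUnion' := fun f hf hd => by
      simpa [hf, MeasurableSet.iUnion hf] using
        Φ.hasSum (hasSum_indicatorConstLp (μ := μ) hp hf hd 1) }

theorem signedMeasureOfDual_apply {p : ℝ≥0∞} [Fact (1 ≤ p)] (hp : p ≠ ∞)
    (Φ : StrongDual ℝ (Lp ℝ p μ)) {s : Set X} (hs : MeasurableSet s) :
    signedMeasureOfDual hp Φ s = Φ (indicatorConstLp p hs (measure_ne_top μ _) 1) := by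
  simp [signedMeasureOfDual, hs]

theorem exists_integrable_dual_indicator {p : ℝ≥0∞} [Fact (1 ≤ p)] (hp : p ≠ ∞)
    (Φ : StrongDual ℝ (Lp ℝ p μ)) :
    ∃ f : X → ℝ, Measurable f ∧ Integrable f μ ∧ ∀ s (hs : MeasurableSet s),
      Φ (indicatorConstLp p hs (measure_ne_top μ _) 1) = ∫ x in s, f x ∂μ := by
  have hac : signedMeasureOfDual hp Φ ≪ᵥ μ.toENNRealVectorMeasure := by
    refine VectorMeasure.AbsolutelyContinuous.mk fun s hs h0 => ?_
    rw [Measure.toENNRealVectorMeasure_apply_measurable hs] at h0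
    rw [signedMeasureOfDual_apply hp Φ hs]
    have : indicatorConstLp p hs (measure_ne_top μ _) (1 : ℝ) = 0 := by
      have hp0 : p ≠ 0 := (one_pos.trans_le (Fact.out : 1 ≤ p)).ne'
      rw [← norm_eq_zero, norm_indicatorConstLp hp0 hp, measureReal_def, h0]
      simp [ENNReal.toReal_eq_zero_iff, hp, hp0]
    rw [this, map_zero]
  have h := SignedMeasure.withDensityᵥ_rnDeriv_eq _ μ hac
  refine ⟨(signedMeasureOfDual hp Φ).rnDeriv μ, SignedMeasure.measurable_rnDeriv _ _,
    SignedMeasure.integrable_rnDeriv _ _, fun s hs => ?_⟩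
  rw [← signedMeasureOfDual_apply hp Φ hs, ← h,
    withDensityᵥ_apply (SignedMeasure.integrable_rnDeriv _ _) hs]
  rw [h]

theorem dual_toLp_eq_integral_of_bounded {p : ℝ≥0∞} [Fact (1 ≤ p)] (hp : p ≠ ∞)
    (Φ : StrongDual ℝ (Lp ℝ p μ)) {f : X → ℝ} (hf : Integrable f μ)
    (hΦ : ∀ s (hs : MeasurableSet s),
      Φ (indicatorConstLp p hs (measure_ne_top μ _) 1) = ∫ x in s, f x ∂μ)
    {g : X → ℝ} (hg : Measurable g) {M : ℝ} (hM : ∀ x, ‖g x‖ ≤ M) (hgp : MemLp g p μ) :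
    Φ (hgp.toLp g) = ∫ x, f x * g x ∂μ := by
  have hsimple : ∀ (s : SimpleFunc X ℝ) (h : MemLp s p μ),
      Φ (h.toLp s) = ∫ x, f x * s x ∂μ := by
    intro s
    induction s using SimpleFunc.induction with
    | const c hs =>
      rename_i s
      intro h
      have : h.toLp _ = c • indicatorConstLp p hs (measure_ne_top μ _) (1 : ℝ) := by
        rw [indicatorConstLp, ← MemLp.toLp_const_smul]
        congr 1
        ext x
        by_cases hx : x ∈ s <;> simp [hx]
      rw [this, map_smul, hΦ s hs, ← integral_indicator hs, smul_eq_mul, ← integral_const_mul]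
      congr 1
      ext x
      by_cases hx : x ∈ s <;> simp [hx, mul_comm]
    | @add s t _ hs ht =>
      intro h
      have hs' : MemLp s p μ := s.memLp_of_isFiniteMeasure p μ
      have ht' : MemLp t p μ := t.memLp_of_isFiniteMeasure p μ
      have hfs : ∀ s : SimpleFunc X ℝ, Integrable (fun x => f x * s x) μ := fun s => by
        obtain ⟨C, hC⟩ := s.exists_forall_norm_le
        exact hf.mul_bdd (c := C) s.measurable.aestronglyMeasurable (ae_of_all _ hC)
      have : h.toLp _ = hs'.toLp s + ht'.toLp t := rfl
      rw [this, map_add, hs hs', ht ht', ← integral_add (hfs s) (hfs t)]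
      simp [mul_add]
  have h1 := (Φ.continuous.tendsto _).comp (SimpleFunc.tendsto_approxOn_range_Lp hp hg hgp)
  refine tendsto_nhds_unique h1 ?_
  simp only [Function.comp_def, hsimple]
  refine tendsto_integral_of_dominated_convergence (fun x => ‖f x‖ * (M + M)) ?_ ?_ ?_ ?_
  · exact fun n => hf.aestronglyMeasurable.mul (SimpleFunc.measurable _).aestronglyMeasurable
  · exact hf.norm.mul_const _
  · refine fun n => ae_of_all _ fun x => ?_
    rw [norm_mul]
    gcongr
    exact (SimpleFunc.norm_approxOn_zero_le hg (by simp) x n).trans (add_le_add (hM x) (hM x))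
  · refine ae_of_all _ fun x => Tendsto.const_mul _ ?_
    exact SimpleFunc.tendsto_approxOn hg (by simp) (subset_closure (by simp))


theorem memLp_of_dual_indicator {r q : ℝ} (hrq : r.HolderConjugate q)
    [Fact (1 ≤ ENNReal.ofReal q)]
    (Φ : StrongDual ℝ (Lp ℝ (ENNReal.ofReal q) μ)) {f : X → ℝ} (hfm : Measurable f)
    (hf : Integrable f μ)
    (hΦ : ∀ s (hs : MeasurableSet s),
      Φ (indicatorConstLp (ENNReal.ofReal q) hs (measure_ne_top μ _) 1) = ∫ x in s, f x ∂μ) :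
    MemLp f (ENNReal.ofReal r) μ := by
  have hr0 : 0 < r := hrq.pos
  have hq0 : 0 < q := hrq.symm.pos
  have hr1 : 0 < r - 1 := hrq.sub_one_pos
  set A : ℕ → Set X := fun n => {x | ‖f x‖ ≤ n}
  have hA : ∀ n, MeasurableSet (A n) := fun n => measurableSet_le hfm.norm measurable_const
  set g : ℕ → X → ℝ := fun n => (A n).indicator fun x => SignType.sign (f x) * ‖f x‖ ^ (r - 1)
  have hgm : ∀ n, Measurable (g n) := fun n => by
    refine Measurable.indicator ?_ (hA n)
    have h1 : Measurable fun x => ((SignType.sign (f x) : SignType) : ℝ) := by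
      have : (fun x => ((SignType.sign (f x) : SignType) : ℝ))
          = fun x => if 0 < f x then 1 else if f x < 0 then -1 else 0 := by
        ext x
        rw [sign_apply]
        split_ifs <;> simp
      rw [this]
      exact Measurable.ite (measurableSet_lt measurable_const hfm) measurable_const
        (Measurable.ite (measurableSet_lt hfm measurable_const) measurable_const measurable_const)
    exact h1.mul (hfm.norm.pow_const _)
  have hsign : ∀ x : ℝ, ‖((SignType.sign x : SignType) : ℝ)‖ ≤ 1 := fun x => by
    rcases lt_trichotomy x 0 with h | h | h <;> simp [h]
  have hgb : ∀ n x, ‖g n x‖ ≤ (n : ℝ) ^ (r - 1) := fun n x => by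
    by_cases hx : x ∈ A n
    · simp only [g, indicator_of_mem hx, norm_mul]
      rw [Real.norm_of_nonneg (Real.rpow_nonneg (norm_nonneg _) _)]
      refine (mul_le_of_le_one_left (by positivity) (hsign _)).trans ?_
      exact Real.rpow_le_rpow (norm_nonneg _) hx hr1.le
    · simp only [g, indicator_of_notMem hx, norm_zero]
      positivity
  have hgp : ∀ n, MemLp (g n) (ENNReal.ofReal q) μ := fun n =>
    MemLp.of_bound (hgm n).aestronglyMeasurable _ (ae_of_all _ (hgb n))
  set h : ℕ → X → ℝ := fun n => (A n).indicator fun x => ‖f x‖ ^ r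
  have hfg : ∀ n x, f x * g n x = h n x := fun n x => by
    by_cases hx : x ∈ A n
    · simp only [g, h, indicator_of_mem hx]
      rw [← mul_assoc, self_mul_sign]
      rcases eq_or_ne (f x) 0 with h0 | h0
      · simp [h0, Real.zero_rpow hr0.ne']
      · have := Real.rpow_add (norm_pos_iff.2 h0) 1 (r - 1)
        rw [Real.rpow_one, add_sub_cancel] at this
        exact this.symm
    · simp [g, h, hx]
  have hgq : ∀ n x, ‖g n x‖ ^ q = h n x := fun n x => by
    by_cases hx : x ∈ A n
    · simp only [g, h, indicator_of_mem hx]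
      rcases eq_or_ne (f x) 0 with h0 | h0
      · simp [h0, Real.zero_rpow hr0.ne', Real.zero_rpow hq0.ne']
      · have : ‖((SignType.sign (f x) : SignType) : ℝ)‖ = 1 := by
          rcases h0.lt_or_gt with h | h <;> simp [h]
        rw [norm_mul, this, one_mul, Real.norm_of_nonneg (Real.rpow_nonneg (norm_nonneg _) _),
          ← Real.rpow_mul (norm_nonneg _), hrq.sub_one_mul_conj]
    · simp [g, h, hx, Real.zero_rpow hq0.ne']
  have hh0 : ∀ n x, 0 ≤ h n x := fun n x => indicator_nonneg (fun _ _ => by positivity) _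
  have hI : ∀ n, ∫ x, h n x ∂μ ≤ ‖Φ‖ ^ r := fun n => by
    have h1 : ∫ x, h n x ∂μ ≤ ‖Φ‖ * (∫ x, h n x ∂μ) ^ q⁻¹ := by
      calc ∫ x, h n x ∂μ = Φ ((hgp n).toLp (g n)) := by
            rw [dual_toLp_eq_integral_of_bounded ENNReal.ofReal_ne_top Φ hf hΦ (hgm n) (hgb n)]
            simp_rw [hfg]
        _ ≤ ‖Φ‖ * ‖(hgp n).toLp (g n)‖ := (le_abs_self _).trans (Φ.le_opNorm _)
        _ = _ := by
            rw [Lp.norm_toLp, (hgp n).eLpNorm_eq_integral_rpow_norm (by simpa using hq0)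
              ENNReal.ofReal_ne_top, ENNReal.toReal_ofReal hq0.le, ENNReal.toReal_ofReal]
            · simp_rw [hgq]
            · simp_rw [hgq]
              exact Real.rpow_nonneg (integral_nonneg (hh0 n)) _
    have hn : 0 ≤ ∫ x, h n x ∂μ := integral_nonneg (hh0 n)
    rcases hn.eq_or_lt with h0 | h0
    · rw [← h0]; positivity
    · have h2 : (∫ x, h n x ∂μ) ^ r⁻¹ ≤ ‖Φ‖ := by
        rw [← hrq.symm.one_sub_inv, Real.rpow_sub h0, Real.rpow_one, div_le_iff₀ (by positivity)]
        exact h1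
      calc ∫ x, h n x ∂μ = ((∫ x, h n x ∂μ) ^ r⁻¹) ^ r := by
            rw [Real.rpow_inv_rpow hn hr0.ne']
        _ ≤ _ := Real.rpow_le_rpow (by positivity) h2 hr0.le
  have hfr : ∫⁻ x, ENNReal.ofReal (‖f x‖ ^ r) ∂μ ≤ ENNReal.ofReal (‖Φ‖ ^ r) := by
    have hlim : Tendsto (fun n => ∫⁻ x, ENNReal.ofReal (h n x) ∂μ) atTop
        (nhds (∫⁻ x, ENNReal.ofReal (‖f x‖ ^ r) ∂μ)) := by
      refine lintegral_tendsto_of_tendsto_of_monotone ?_ ?_ ?_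
      · exact fun n => ((hfm.norm.pow_const _).indicator (hA n)).ennreal_ofReal.aemeasurable
      · refine ae_of_all _ fun x m n hmn => ENNReal.ofReal_le_ofReal ?_
        refine indicator_le_indicator_of_subset (fun y hy => ?_) (fun _ => by positivity) x
        exact le_trans (show ‖f y‖ ≤ m from hy) (by exact_mod_cast hmn)
      · refine ae_of_all _ fun x => tendsto_const_nhds.congr' ?_
        filter_upwards [eventually_ge_atTop ⌈‖f x‖⌉₊] with n hn
        have : x ∈ A n := Nat.ceil_le.1 hn
        simp [h, indicator_of_mem this]
    refine le_of_tendsto' hlim fun n => ?_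
    rw [← ofReal_integral_eq_lintegral_ofReal _ (ae_of_all _ (hh0 n))]
    · exact ENNReal.ofReal_le_ofReal (hI n)
    · refine Integrable.of_bound
        ((hfm.norm.pow_const _).indicator (hA n)).aestronglyMeasurable ((n : ℝ) ^ r)
        (ae_of_all _ fun x => ?_)
      rw [Real.norm_of_nonneg (hh0 n x)]
      by_cases hx : x ∈ A n
      · simp only [h, indicator_of_mem hx]
        exact Real.rpow_le_rpow (norm_nonneg _) hx hr0.le
      · simp only [h, indicator_of_notMem hx]
        positivity
  rw [← integrable_norm_rpow_iff hfm.aestronglyMeasurable (by simpa using hr0)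
    ENNReal.ofReal_ne_top, ENNReal.toReal_ofReal hr0.le]
  exact lintegral_ofReal_ne_top_iff_integrable (hfm.norm.pow_const _).aestronglyMeasurable
    (ae_of_all _ fun x => by positivity) |>.1 (hfr.trans_lt ENNReal.ofReal_lt_top).ne

/-- Continuous functionals on `L^q` of a finite measure are represented by `L^r` functions. -/
theorem exists_memLp_dual {r q : ℝ} (hrq : r.HolderConjugate q)
    [Fact (1 ≤ ENNReal.ofReal q)] (Φ : StrongDual ℝ (Lp ℝ (ENNReal.ofReal q) μ)) :
    ∃ f : X → ℝ, Measurable f ∧ MemLp f (ENNReal.ofReal r) μ ∧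
      ∀ ψ : Lp ℝ (ENNReal.ofReal q) μ, Φ ψ = ∫ x, f x * ψ x ∂μ := by
  obtain ⟨f, hfm, hf, hΦ⟩ := exists_integrable_dual_indicator ENNReal.ofReal_ne_top Φ
  have hfp := memLp_of_dual_indicator hrq Φ hfm hf hΦ
  refine ⟨f, hfm, hfp, ?_⟩
  have := hrq.ennrealOfReal
  have : Fact (1 ≤ ENNReal.ofReal r) := ⟨by simpa using hrq.lt.le⟩
  set B := (ContinuousLinearMap.mul ℝ ℝ).lpPairing μ (ENNReal.ofReal r) (ENNReal.ofReal q)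
  have hB : ∀ ψ, B (hfp.toLp f) ψ = ∫ x, f x * ψ x ∂μ := fun ψ => by
    simp only [B, ContinuousLinearMap.lpPairing_eq_integral]
    refine integral_congr_ae ?_
    filter_upwards [hfp.coeFn_toLp] with x hx
    simp [hx]
  intro ψ
  rw [← hB]
  refine Lp.induction ENNReal.ofReal_ne_top (motive := fun ψ => Φ ψ = B (hfp.toLp f) ψ)
    ?_ ?_ ?_ ψ
  · intro c s hs hμs
    have : (Lp.simpleFunc.indicatorConst (ENNReal.ofReal q) hs hμs.ne c : Lp ℝ _ μ)
        = c • indicatorConstLp (ENNReal.ofReal q) hs (measure_ne_top μ _) (1 : ℝ) := by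
      rw [Lp.simpleFunc.coe_indicatorConst, indicatorConstLp, indicatorConstLp,
        ← MemLp.toLp_const_smul]
      congr 1
      ext x
      by_cases hx : x ∈ s <;> simp [hx]
    rw [this, map_smul, map_smul, hΦ s hs, hB, ← integral_indicator hs]
    congr 1
    refine integral_congr_ae ?_
    filter_upwards [indicatorConstLp_coeFn (p := ENNReal.ofReal q) (hs := hs)
      (hμs := measure_ne_top μ s) (c := (1 : ℝ))] with x hx
    rw [hx]
    by_cases hx : x ∈ s <;> simp [hx]
  · intro f g hf hg _ h1 h2
    rw [map_add, map_add, h1, h2]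
  · exact isClosed_eq Φ.continuous (B (hfp.toLp f)).continuous

/-- Bounded sequences in `L^r` of a finite measure have weakly convergent subsequences. -/
theorem exists_subseq_weak_tendsto [MeasurableSpace.CountablyGenerated X] {r q : ℝ}
    (hrq : r.HolderConjugate q) {u : ℕ → X → ℝ}
    (hu : ∀ k, MemLp (u k) (ENNReal.ofReal r) μ) {C : ℝ}
    (hC : ∀ k, ∫ x, ‖u k x‖ ^ r ∂μ ≤ C) :
    ∃ f : X → ℝ, Measurable f ∧ MemLp f (ENNReal.ofReal r) μ ∧ ∃ φ : ℕ → ℕ, StrictMono φ ∧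
      ∀ ψ : X → ℝ, MemLp ψ (ENNReal.ofReal q) μ →
        Tendsto (fun k => ∫ x, u (φ k) x * ψ x ∂μ) atTop (nhds (∫ x, f x * ψ x ∂μ)) := by
  have := hrq.ennrealOfReal
  have : Fact (1 ≤ ENNReal.ofReal r) := ⟨by simpa using hrq.lt.le⟩
  have : Fact (1 ≤ ENNReal.ofReal q) := ⟨by simpa using hrq.symm.lt.le⟩
  have : Fact (ENNReal.ofReal q ≠ ∞) := ⟨ENNReal.ofReal_ne_top⟩
  set B := (ContinuousLinearMap.mul ℝ ℝ).lpPairing μ (ENNReal.ofReal r) (ENNReal.ofReal q)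
  have hB : ∀ {f ψ : X → ℝ} (hf : MemLp f (ENNReal.ofReal r) μ)
      (hψ : MemLp ψ (ENNReal.ofReal q) μ),
      B (hf.toLp f) (hψ.toLp ψ) = ∫ x, f x * ψ x ∂μ := fun hf hψ => by
    simp only [B, ContinuousLinearMap.lpPairing_eq_integral]
    refine integral_congr_ae ?_
    filter_upwards [hf.coeFn_toLp, hψ.coeFn_toLp] with x hx hx'
    simp [hx, hx']
  have hnorm : ∀ k, ‖(hu k).toLp (u k)‖ ≤ C ^ r⁻¹ := fun k => by
    have h0 : 0 ≤ ∫ x, ‖u k x‖ ^ r ∂μ := integral_nonneg fun x => by positivity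
    rw [Lp.norm_toLp, (hu k).eLpNorm_eq_integral_rpow_norm (by simpa using hrq.pos)
      ENNReal.ofReal_ne_top, ENNReal.toReal_ofReal hrq.nonneg,
      ENNReal.toReal_ofReal (Real.rpow_nonneg h0 _)]
    exact Real.rpow_le_rpow h0 (hC k) (inv_nonneg.2 hrq.nonneg)
  obtain ⟨Φ, -, φ, hφ, hlim⟩ := WeakDual.isSeqCompact_closedBall ℝ (Lp ℝ (ENNReal.ofReal q) μ)
    0 (‖B‖ * C ^ r⁻¹) (x := fun k => StrongDual.toWeakDual (B ((hu k).toLp (u k)))) fun k => by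
      simp only [mem_preimage, Metric.mem_closedBall, dist_zero_right]
      exact (B.le_opNorm _).trans (by gcongr; exact hnorm k)
  obtain ⟨f, hfm, hfp, hf⟩ := exists_memLp_dual hrq (WeakDual.toStrongDual Φ)
  refine ⟨f, hfm, hfp, φ, hφ, fun ψ hψ => ?_⟩
  have h1 := ((WeakDual.eval_continuous (hψ.toLp ψ)).tendsto Φ).comp hlim
  have h2 : Φ (hψ.toLp ψ) = ∫ x, f x * ψ x ∂μ := by
    refine (hf _).trans (integral_congr_ae ?_)
    filter_upwards [hψ.coeFn_toLp] with x hx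
    simp [hx]
  rw [h2] at h1
  refine h1.congr fun k => ?_
  exact hB (hu (φ k)) hψ

end Riesz

section Holder
variable {X : Type*} [MeasurableSpace X] {μ : Measure X} {r q : ℝ}

theorem memLp_ofReal_iff_integrable_abs_rpow {f : X → ℝ} (hf : AEStronglyMeasurable f μ)
    (hr : 0 < r) : MemLp f (ENNReal.ofReal r) μ ↔ Integrable (fun x => |f x| ^ r) μ := by
  rw [← integrable_norm_rpow_iff hf (by simpa using hr) ENNReal.ofReal_ne_top,
    ENNReal.toReal_ofReal hr.le]
  rfl

theorem tendsto_setIntegral_mul_nhds_zero (hrq : r.HolderConjugate q) {u : ℕ → X → ℝ}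
    (hu : ∀ k, MemLp (u k) (ENNReal.ofReal r) μ) {C : ℝ} (hC : ∀ k, ∫ x, ‖u k x‖ ^ r ∂μ ≤ C)
    {ψ : X → ℝ} (hψ : MemLp ψ (ENNReal.ofReal q) μ) {B : ℕ → Set X}
    (hB : Tendsto (fun k => μ (B k)) atTop (nhds 0)) :
    Tendsto (fun k => ∫ x in B k, u k x * ψ x ∂μ) atTop (nhds 0) := by
  have hψi : Integrable (fun x => ‖ψ x‖ ^ q) μ :=
    (memLp_ofReal_iff_integrable_abs_rpow hψ.1 hrq.symm.pos).1 hψ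
  have hlim : Tendsto (fun k => C ^ (1 / r) * (∫ x in B k, ‖ψ x‖ ^ q ∂μ) ^ (1 / q)) atTop
      (nhds 0) := by
    have h := ((hψi.tendsto_setIntegral_nhds_zero hB).rpow_const (p := 1 / q)
      (Or.inr (one_div_pos.2 hrq.symm.pos).le)).const_mul (C ^ (1 / r))
    rwa [Real.zero_rpow (one_div_pos.2 hrq.symm.pos).ne', mul_zero] at h
  refine squeeze_zero_norm (fun k => ?_) hlim
  calc ‖∫ x in B k, u k x * ψ x ∂μ‖ ≤ ∫ x in B k, ‖u k x‖ * ‖ψ x‖ ∂μ := by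
        simpa only [norm_mul] using
          norm_integral_le_integral_norm (μ := μ.restrict (B k)) fun x => u k x * ψ x
    _ ≤ (∫ x in B k, ‖u k x‖ ^ r ∂μ) ^ (1 / r) * (∫ x in B k, ‖ψ x‖ ^ q ∂μ) ^ (1 / q) :=
        integral_mul_norm_le_Lp_mul_Lq hrq ((hu k).restrict _) (hψ.restrict _)
    _ ≤ C ^ (1 / r) * (∫ x in B k, ‖ψ x‖ ^ q ∂μ) ^ (1 / q) := by
        gcongr
        · exact one_div_nonneg.2 hrq.nonneg
        · refine (setIntegral_le_integral ?_ ?_).trans (hC k)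
          · exact (memLp_ofReal_iff_integrable_abs_rpow (hu k).1 hrq.pos).1 (hu k)
          · exact Eventually.of_forall fun x => by positivity

end Holder

section Unfolding
open scoped ENNReal
variable {d : ℕ}

local notation "E[" d "]" => EuclideanSpace ℝ (Fin d)

theorem volume_euclidean_box {s : Fin d → Set ℝ} (hs : ∀ i, MeasurableSet (s i)) :
    volume {x : E[d] | ∀ i, x i ∈ s i} = ∏ i, volume (s i) := by
  have h := (PiLp.volume_preserving_ofLp (Fin d)).measure_preimage
    (MeasurableSet.univ_pi hs).nullMeasurableSet
  rw [volume_pi_pi] at h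
  rw [← h]
  congr 1
  ext x
  simp

theorem measurableSet_Ycell : MeasurableSet (Ycell d) := by
  simp only [Ycell, ofPred_forall]
  exact MeasurableSet.iInter fun i => measurableSet_Ioc.preimage (by fun_prop)

theorem volume_Ycell : volume (Ycell d) = 1 := by
  rw [Ycell, volume_euclidean_box fun _ => measurableSet_Ioc]
  simp

instance : IsProbabilityMeasure (volume.restrict (Ycell d)) :=
  ⟨by rw [Measure.restrict_apply_univ, volume_Ycell]⟩

/-- The lattice point with given integer coordinates. -/
def latticePoint (n : Fin d → ℤ) : E[d] := WithLp.toLp 2 fun i => (n i : ℝ)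

theorem measurable_floorMap : Measurable fun (x : E[d]) (i : Fin d) => ⌊x i⌋ :=
  measurable_pi_lambda _ fun i => Int.measurable_floor.comp (by fun_prop)

theorem measurable_Ncell : Measurable (Ncell : E[d] → E[d]) := by
  refine (WithLp.measurable_toLp 2 _).comp (measurable_pi_lambda _ fun i => ?_)
  have : Measurable fun x : E[d] => ⌊x i⌋ := Int.measurable_floor.comp (by fun_prop)
  exact (measurable_of_countable _).comp this

theorem map_floorMap_volume :
    Measure.map (fun (x : E[d]) (i : Fin d) => ⌊x i⌋) volume = Measure.count := by
  refine Measure.ext_of_singleton fun n => ?_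
  rw [Measure.map_apply measurable_floorMap (measurableSet_singleton n), Measure.count_singleton]
  have : (fun (x : E[d]) (i : Fin d) => ⌊x i⌋) ⁻¹' {n}
      = {x | ∀ i, x i ∈ Ico (n i : ℝ) (n i + 1)} := by
    ext x
    simp [funext_iff, Int.floor_eq_iff]
  rw [this, volume_euclidean_box fun _ => measurableSet_Ico]
  simp

theorem tsum_indicator_Ycell (g : E[d] → ℝ≥0∞) (z : E[d]) :
    ∑' n : Fin d → ℤ, (Ycell d).indicator (fun _ => g z) (z - latticePoint n) = g z := by
  have hmem : ∀ n : Fin d → ℤ, z - latticePoint n ∈ Ycell d ↔ n = fun i => ⌈z i⌉ - 1 := by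
    intro n
    simp only [Ycell, latticePoint, mem_ofPred_eq, funext_iff]
    refine forall_congr' fun i => ?_
    rw [eq_sub_iff_add_eq, eq_comm, Int.ceil_eq_iff]
    simp only [PiLp.sub_apply, mem_Ioc]
    push_cast
    constructor <;> rintro ⟨h1, h2⟩ <;> constructor <;> linarith
  rw [tsum_eq_single (fun i => ⌈z i⌉ - 1)]
  · rw [indicator_of_mem ((hmem _).2 rfl)]
  · intro n hn
    rw [indicator_of_notMem (fun h => hn ((hmem n).1 h))]

theorem measurePreserving_Ncell_add :
    MeasurePreserving (fun p : E[d] × E[d] => Ncell p.1 + p.2)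
      (volume.prod (volume.restrict (Ycell d))) volume := by
  have hm : Measurable fun p : E[d] × E[d] => Ncell p.1 + p.2 :=
    (measurable_Ncell.comp measurable_fst).add measurable_snd
  refine ⟨hm, Measure.ext_of_lintegral _ fun g hg => ?_⟩
  rw [lintegral_map hg hm, lintegral_prod_symm' (fun p : E[d] × E[d] => g (Ncell p.1 + p.2)) (hg.comp hm)]
  have h1 : ∀ y : E[d], ∫⁻ x : E[d], g (Ncell x + y) = ∑' n, g (latticePoint n + y) := by
    intro y
    rw [← lintegral_count, ← map_floorMap_volume,
      lintegral_map (measurable_of_countable _) measurable_floorMap]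
    rfl
  simp_rw [h1]
  rw [lintegral_tsum (f := fun (n : Fin d → ℤ) y => g (latticePoint n + y))
    fun n => (hg.comp (measurable_const_add _)).aemeasurable]
  have h2 : ∀ n : Fin d → ℤ, ∫⁻ y in Ycell d, g (latticePoint n + y)
      = ∫⁻ z, (Ycell d).indicator (fun _ => g z) (z - latticePoint n) := by
    intro n
    rw [← lintegral_indicator measurableSet_Ycell,
      ← lintegral_sub_right_eq_self _ (latticePoint n)]
    refine lintegral_congr fun z => ?_
    by_cases h : z - latticePoint n ∈ Ycell d <;> simp [h]
  simp_rw [h2]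
  rw [← lintegral_tsum]
  · simp_rw [tsum_indicator_Ycell]
  · intro n
    have : (fun z => (Ycell d).indicator (fun _ => g z) (z - latticePoint n))
        = ((fun z => z - latticePoint n) ⁻¹' Ycell d).indicator g := by
      ext z
      by_cases h : z - latticePoint n ∈ Ycell d <;> simp [h]
    rw [this]
    exact (hg.indicator (measurableSet_Ycell.preimage (measurable_sub_const _))).aemeasurable

theorem measurePreserving_Tcell {ε : ℝ} (hε : 0 < ε) :
    MeasurePreserving (fun p : E[d] × E[d] => Tcell ε p.1 p.2)
      (volume.prod (volume.restrict (Ycell d))) volume := by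
  have hS := measurePreserving_Ncell_add (d := d)
  have hs : Measurable fun x : E[d] => ε⁻¹ • x := measurable_const_smul _
  have hs' : Measurable fun x : E[d] => ε • x := measurable_const_smul _
  have hT : (fun p : E[d] × E[d] => Tcell ε p.1 p.2)
      = (fun x => ε • x) ∘ (fun p : E[d] × E[d] => Ncell p.1 + p.2)
        ∘ Prod.map (fun x => ε⁻¹ • x) id := rfl
  have hm := hs.prodMap (measurable_id (α := E[d]))
  refine ⟨hT ▸ hs'.comp (hS.measurable.comp hm), ?_⟩
  rw [hT, ← Measure.map_map hs' (hS.measurable.comp hm), ← Measure.map_map hS.measurable hm,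
    ← Measure.map_prod_map _ _ hs measurable_id, Measure.map_id,
    Measure.map_addHaar_smul _ (inv_ne_zero hε.ne'), Measure.prod_smul_left, Measure.map_smul,
    hS.map_eq, Measure.map_smul, Measure.map_addHaar_smul _ hε.ne', smul_smul,
    ← ENNReal.ofReal_mul (abs_nonneg _), ← abs_mul, inv_pow, inv_inv, mul_inv_cancel₀
      (pow_pos hε _).ne']
  simp

theorem dist_Tcell_le {ε : ℝ} (hε : 0 < ε) (x : E[d]) {y : E[d]} (hy : y ∈ Ycell d) :
    dist x (Tcell ε x y) ≤ ε * √d := by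
  have h : Tcell ε x y - x = ε • (Ncell (ε⁻¹ • x) + y - ε⁻¹ • x) := by
    rw [Tcell, smul_sub, smul_inv_smul₀ hε.ne']
  rw [dist_comm, dist_eq_norm, h, norm_smul, Real.norm_of_nonneg hε.le]
  gcongr
  rw [EuclideanSpace.norm_eq]
  refine Real.sqrt_le_sqrt ?_
  calc _ ≤ ∑ _i : Fin d, (1 : ℝ) := Finset.sum_le_sum fun i _ => ?_
    _ = d := by simp
  rw [Real.norm_eq_abs, sq_abs, sq_le_one_iff_abs_le_one, abs_le]
  have h1 := Int.floor_le (ε⁻¹ * x i)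
  have h2 := Int.lt_floor_add_one (ε⁻¹ * x i)
  have h3 := hy i
  simp only [Ncell, PiLp.sub_apply, PiLp.add_apply, PiLp.smul_apply, smul_eq_mul]
  constructor <;> linarith [h3.1, h3.2]

/-- The unfolded set differs little from the original one: the points outside `Ω` that are
mapped into `Ω` by `T_ε` have vanishing measure. -/
theorem tendsto_measure_Tcell_mem_diff {Ω : Set E[d]} (hΩ : MeasurableSet Ω)
    (hΩt : volume Ω ≠ ∞) {ε : ℕ → ℝ} (hε : ∀ k, 0 < ε k) (hε0 : Tendsto ε atTop (nhds 0)) :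
    Tendsto (fun k => (volume.prod (volume.restrict (Ycell d)))
      {p : E[d] × E[d] | p.1 ∉ Ω ∧ Tcell (ε k) p.1 p.2 ∈ Ω}) atTop (nhds 0) := by
  rw [ENNReal.tendsto_nhds_zero]
  intro δ hδ
  obtain ⟨K, hKΩ, hK, hKδ⟩ := hΩ.exists_isCompact_sdiff_lt hΩt (ENNReal.half_pos hδ.ne').ne'
  have hKt : volume K ≠ ∞ := hK.measure_lt_top.ne
  have hlim : Tendsto (fun k => volume (Metric.cthickening (ε k * √d) K) - volume K) atTop
      (nhds 0) := by
    have h0 : Tendsto (fun k => ε k * √d) atTop (nhds 0) := by simpa using hε0.mul_const √d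
    have := ENNReal.Tendsto.sub ((tendsto_measure_cthickening_of_isCompact (μ := volume) hK).comp h0)
      (tendsto_const_nhds (x := volume K)) (Or.inl hKt)
    rwa [tsub_self] at this
  filter_upwards [ENNReal.tendsto_nhds_zero.1 hlim (δ / 2) (ENNReal.half_pos hδ.ne')] with k hk
  have hsub : ({p : E[d] × E[d] | p.1 ∉ Ω ∧ Tcell (ε k) p.1 p.2 ∈ Ω} : Set (E[d] × E[d]))
      ⊆ ((fun p : E[d] × E[d] => Tcell (ε k) p.1 p.2) ⁻¹' (Ω \ K)
        ∪ (Metric.cthickening (ε k * √d) K \ K) ×ˢ univ) ∪ univ ×ˢ (Ycell d)ᶜ := by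
    rintro ⟨x, y⟩ ⟨hx, hT⟩
    by_cases hy : y ∈ Ycell d
    · left
      by_cases hTK : Tcell (ε k) x y ∈ K
      · refine Or.inr ⟨⟨?_, fun h => hx (hKΩ h)⟩, mem_univ _⟩
        exact Metric.mem_cthickening_of_dist_le _ _ _ _ hTK (dist_Tcell_le (hε k) x hy)
      · exact Or.inl ⟨hT, hTK⟩
    · exact Or.inr ⟨mem_univ _, hy⟩
  refine (measure_mono hsub).trans ((measure_union_le _ _).trans ?_)
  have h3 : (volume.prod (volume.restrict (Ycell d))) ((univ : Set E[d]) ×ˢ (Ycell d)ᶜ) = 0 := by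
    rw [Measure.prod_prod, Measure.restrict_apply measurableSet_Ycell.compl]
    simp
  rw [h3, add_zero]
  refine (measure_union_le _ _).trans ?_
  rw [(measurePreserving_Tcell (hε k)).measure_preimage
    (hΩ.diff hK.measurableSet).nullMeasurableSet, Measure.prod_prod, measure_univ, mul_one,
    measure_sdiff (Metric.self_subset_cthickening K) hK.measurableSet.nullMeasurableSet hKt]
  exact (add_le_add hKδ.le hk).trans (ENNReal.add_halves δ).le

end Unfolding


/-- weak two-scale compactness: if `{v^ε}_{ε∈(0,1)}` is bounded in
`L^r(Ω)` (`1 < r < ∞`, `Ω` a bounded domain, functions extended by zero outside `Ω`),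
then there exist `v⁰ ∈ L^r(Ω × Y)` and a sequence `ε_k → 0` such that
`v^{ε_k} ⇀ v⁰` weakly two-scale in `L^r(Ω × Y)`. -/
theorem stmt5 {d : ℕ} (hd : 1 ≤ d)
    (Ω : Set (EuclideanSpace ℝ (Fin d))) (hΩm : MeasurableSet Ω)
    (hΩb : Bornology.IsBounded Ω)
    (r r' : ℝ) (hr : 1 < r) (hr' : r' = r / (r - 1))
    (v : ℝ → EuclideanSpace ℝ (Fin d) → ℝ)
    (hvmeas : ∀ ε, Measurable (v ε))
    (hvzero : ∀ ε : ℝ, ∀ x ∉ Ω, v ε x = 0)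
    (hvLr : ∀ ε : ℝ, ε ∈ Set.Ioo (0 : ℝ) 1 → IntegrableOn (fun x => |v ε x| ^ r) Ω)
    (hbound : ∃ C : ℝ, ∀ ε : ℝ, ε ∈ Set.Ioo (0 : ℝ) 1 →
      ∫ x in Ω, |v ε x| ^ r ≤ C) :
    ∃ v0 : EuclideanSpace ℝ (Fin d) → EuclideanSpace ℝ (Fin d) → ℝ,
      Measurable (fun p : EuclideanSpace ℝ (Fin d) × EuclideanSpace ℝ (Fin d) =>
        v0 p.1 p.2) ∧
      IntegrableOn
        (fun p : EuclideanSpace ℝ (Fin d) × EuclideanSpace ℝ (Fin d) =>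
          |v0 p.1 p.2| ^ r) (Ω ×ˢ Ycell d) ∧
      ∃ εs : ℕ → ℝ,
        (∀ k, εs k ∈ Set.Ioo (0 : ℝ) 1) ∧
        Tendsto εs atTop (nhds 0) ∧
        ∀ ψ : EuclideanSpace ℝ (Fin d) → EuclideanSpace ℝ (Fin d) → ℝ,
          Measurable (fun p : EuclideanSpace ℝ (Fin d) × EuclideanSpace ℝ (Fin d) =>
            ψ p.1 p.2) →
          IntegrableOn
            (fun p : EuclideanSpace ℝ (Fin d) × EuclideanSpace ℝ (Fin d) =>
              |ψ p.1 p.2| ^ r') (Set.univ ×ˢ Ycell d) →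
          Tendsto (fun k : ℕ =>
              ∫ x : EuclideanSpace ℝ (Fin d), ∫ y in Ycell d,
                v (εs k) (Tcell (εs k) x y) * ψ x y)
            atTop (nhds (∫ x in Ω, ∫ y in Ycell d, v0 x y * ψ x y)) := by
  obtain ⟨C, hC⟩ := hbound
  have hrq : r.HolderConjugate r' := (Real.holderConjugate_iff_eq_conjExponent hr).2 hr'
  let E := EuclideanSpace ℝ (Fin d)
  let μ : Measure (E × E) := volume.prod (volume.restrict (Ycell d))
  have hμΩ : μ.restrict (Ω ×ˢ univ) = (volume.restrict Ω).prod (volume.restrict (Ycell d)) := by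
    rw [← Measure.prod_restrict, Measure.restrict_univ]
  have hμvol : (volume.restrict Ω).prod (volume.restrict (Ycell d))
      = (volume : Measure (E × E)).restrict (Ω ×ˢ Ycell d) := Measure.prod_restrict _ _
  have hμuniv : μ = (volume : Measure (E × E)).restrict (univ ×ˢ Ycell d) := by
    rw [Measure.volume_eq_prod, ← Measure.prod_restrict, Measure.restrict_univ]
  have hΩt : volume Ω ≠ ⊤ := hΩb.measure_lt_top.ne
  have hΩE : MeasurableSet (Ω ×ˢ (univ : Set E)) := hΩm.prod MeasurableSet.univ
  have : IsFiniteMeasure (volume.restrict Ω) := ⟨by simpa using hΩt.lt_top⟩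
  have hvzero' : ∀ ε, ∀ x ∉ Ω, |v ε x| ^ r = 0 := fun ε x hx => by
    rw [hvzero ε x hx, abs_zero, Real.zero_rpow hrq.ne_zero]
  have hvi : ∀ ε ∈ Ioo (0 : ℝ) 1, Integrable (fun x => |v ε x| ^ r) := fun ε hε =>
    (hvLr ε hε).integrable_of_forall_notMem_eq_zero (hvzero' ε)
  have hvC : ∀ ε ∈ Ioo (0 : ℝ) 1, ∫ x, |v ε x| ^ r ≤ C := fun ε hε => by
    rw [← setIntegral_eq_integral_of_forall_compl_eq_zero (hvzero' ε)]
    exact hC ε hε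
  let e : ℕ → ℝ := fun k => 1 / ((k : ℝ) + 2)
  have he : ∀ k, e k ∈ Ioo (0 : ℝ) 1 := fun k => by
    have hk : (0 : ℝ) ≤ k := k.cast_nonneg
    exact ⟨by positivity, by rw [div_lt_one (by positivity)]; linarith⟩
  have he0 : Tendsto e atTop (nhds 0) :=
    tendsto_const_nhds.div_atTop (tendsto_natCast_atTop_atTop.atTop_add tendsto_const_nhds)
  let u : ℕ → E × E → ℝ := fun k p => v (e k) (Tcell (e k) p.1 p.2)
  have hT : ∀ k, MeasurePreserving (fun p : E × E => Tcell (e k) p.1 p.2) μ volume := fun k =>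
    measurePreserving_Tcell (he k).1
  have hu : ∀ k, MemLp (u k) (ENNReal.ofReal r) μ := fun k =>
    ((memLp_ofReal_iff_integrable_abs_rpow (hvmeas _).aestronglyMeasurable hrq.pos).2
      (hvi _ (he k))).comp_measurePreserving (hT k)
  have huC : ∀ k, ∫ p, ‖u k p‖ ^ r ∂μ ≤ C := fun k => by
    refine le_of_eq_of_le ?_ (hvC _ (he k))
    rw [← (hT k).map_eq, integral_map (hT k).aemeasurable]
    · rfl
    · exact ((hvmeas _).abs.pow_const r).aestronglyMeasurable
  have huΩC : ∀ k, ∫ p, ‖u k p‖ ^ r ∂(μ.restrict (Ω ×ˢ univ)) ≤ C := fun k =>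
    (setIntegral_le_integral ((memLp_ofReal_iff_integrable_abs_rpow (hu k).1 hrq.pos).1 (hu k))
      (Eventually.of_forall fun x => by positivity)).trans (huC k)
  have : IsFiniteMeasure (μ.restrict (Ω ×ˢ univ)) := hμΩ ▸ inferInstance
  obtain ⟨f, hfm, hf, φ, hφ, hlim⟩ :=
    exists_subseq_weak_tendsto hrq (fun k => (hu k).restrict (Ω ×ˢ univ)) huΩC
  refine ⟨fun x y => f (x, y), hfm, ?_, e ∘ φ, fun k => he _, he0.comp hφ.tendsto_atTop,
    fun ψ hψm hψi => ?_⟩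
  · rw [IntegrableOn, ← hμvol, ← hμΩ]
    exact (memLp_ofReal_iff_integrable_abs_rpow hf.1 hrq.pos).1 hf
  let Ψ : E × E → ℝ := fun p => ψ p.1 p.2
  have hΨ : MemLp Ψ (ENNReal.ofReal r') μ := by
    rw [memLp_ofReal_iff_integrable_abs_rpow hψm.aestronglyMeasurable hrq.symm.pos, hμuniv]
    exact hψi
  have := hrq.ennrealOfReal
  have huΨ : ∀ k, Integrable (fun p => u k p * Ψ p) μ := fun k => (hu k).integrable_mul hΨ
  have hfΨ : Integrable (fun p => f p * Ψ p) (μ.restrict (Ω ×ˢ univ)) :=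
    hf.integrable_mul (hΨ.restrict _)
  have hlimΩ := hlim Ψ (hΨ.restrict _)
  let B : ℕ → Set (E × E) := fun k => {p | p.1 ∉ Ω ∧ Tcell ((e ∘ φ) k) p.1 p.2 ∈ Ω}
  have hB : Tendsto (fun k => μ (B k)) atTop (nhds 0) :=
    tendsto_measure_Tcell_mem_diff hΩm hΩt (fun k => (he _).1) (he0.comp hφ.tendsto_atTop)
  have hBlim := tendsto_setIntegral_mul_nhds_zero hrq (fun k => hu (φ k)) (fun k => huC (φ k))
    hΨ hB
  have hcompl : ∀ k, ∫ p in (Ω ×ˢ univ)ᶜ, u (φ k) p * Ψ p ∂μ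
      = ∫ p in B k, u (φ k) p * Ψ p ∂μ := fun k => by
    refine setIntegral_eq_of_subset_of_forall_sdiff_eq_zero hΩE.compl ?_ ?_
    · rintro p ⟨hp, -⟩ h
      exact hp h.1
    · rintro p ⟨hp, hpB⟩
      have : Tcell (e (φ k)) p.1 p.2 ∉ Ω := fun h => hpB ⟨fun h1 => hp ⟨h1, mem_univ _⟩, h⟩
      simp [u, hvzero _ _ this]
  have hsum := hlimΩ.add hBlim
  rw [add_zero, hμΩ, integral_prod _ (hμΩ ▸ hfΨ)] at hsum
  refine hsum.congr fun k => ?_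
  rw [← hμΩ, ← hcompl, integral_add_compl hΩE (huΨ _)]
  exact integral_prod _ (huΨ _)
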